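/- Let A be an indecomposable, invertible, simply-laced GCM, V := ℝⁿ with the nondegenerate form b(x,y) := xᵀAy, s_i the fundamental reflections, Sym²(V) ⊆ V ⊗ V the flip-fixed tensors, and b₂ the restriction of b ⊗ b to Sym²(V). Then: (i) the space of w ∈ Sym²(V) with (s_i ⊗ s_i)(w) = w for all i is exactly ℝ·Ψ, where Ψ := Σ_{k,l} ω^{kl} e_k ⊗ e_l with (ω^{kl}) the inverse Gram matrix of b; (ii) for every subspace U ⊆ Sym²(V) with (s_i ⊗ s_i)(U) ⊆ U for all i, one has U ∩ U^⊥ = {0}, where U^⊥ := {w ∈ Sym²(V) : b₂(w,u) = 0 for all u ∈ U}; consequently Sym²(V) = U ⊕ U^⊥ with both summands invariant, so Sym²(V) is a completely reducible W(A)-module. -/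

import Mathlib

open scoped TensorProduct BigOperators

noncomputable section

/-- The bilinear form `b(x,y) = xᵀAy` on `ℝⁿ`. -/
def formA {n : ℕ} (A : Matrix (Fin n) (Fin n) ℤ) :
    LinearMap.BilinForm ℝ (Fin n → ℝ) :=
  Matrix.toBilin' (A.map ((↑) : ℤ → ℝ))

/-- The reflection `s_α(v) = v − b(α,v)·α`. -/
def reflB {V : Type*} [AddCommGroup V] [Module ℝ V]
    (b : LinearMap.BilinForm ℝ V) (α : V) : Module.End ℝ V :=
  LinearMap.id - LinearMap.smulRight (b α) α

/-- The induced action `s_i ⊗ s_i` on `V ⊗ V` for `V = ℝⁿ`. -/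
def ssA {n : ℕ} (A : Matrix (Fin n) (Fin n) ℤ) (i : Fin n) :
    Module.End ℝ ((Fin n → ℝ) ⊗[ℝ] (Fin n → ℝ)) :=
  TensorProduct.map (reflB (formA A) (Pi.single i 1)) (reflB (formA A) (Pi.single i 1))

/-- The symmetric element `Ψ = Σ_{k,l} ω^{kl}·e_k ⊗ e_l`. -/
def PsiElt {n : ℕ} (ωInv : Matrix (Fin n) (Fin n) ℝ) :
    (Fin n → ℝ) ⊗[ℝ] (Fin n → ℝ) :=
  ∑ k, ∑ l, ωInv k l • ((Pi.single k 1 : Fin n → ℝ) ⊗ₜ[ℝ] (Pi.single l 1 : Fin n → ℝ))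

/-- The submodule `Sym²(V) ⊆ V ⊗ V` of flip-fixed tensors. -/
def sym2 (n : ℕ) : Submodule ℝ ((Fin n → ℝ) ⊗[ℝ] (Fin n → ℝ)) :=
  LinearMap.eqLocus (TensorProduct.comm ℝ (Fin n → ℝ) (Fin n → ℝ)).toLinearMap LinearMap.id

/-- The induced form `b ⊗ b` on `V ⊗ V`. -/
def form2 {n : ℕ} (A : Matrix (Fin n) (Fin n) ℤ) :
    LinearMap.BilinForm ℝ ((Fin n → ℝ) ⊗[ℝ] (Fin n → ℝ)) :=
  LinearMap.BilinForm.tmul (formA A) (formA A)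

section Reflections

variable {V : Type*} [AddCommGroup V] [Module ℝ V] (b : LinearMap.BilinForm ℝ V)

/-- The diagonal action `s_α ⊗ s_α` of a reflection on `V ⊗ V`. -/
def reflSq (α : V) : Module.End ℝ (V ⊗[ℝ] V) :=
  TensorProduct.map (reflB b α) (reflB b α)

/-- The contraction `x ⊗ y ↦ b(α,x)·y`. -/
def contract (α : V) : V ⊗[ℝ] V →ₗ[ℝ] V :=
  (TensorProduct.lid ℝ V).toLinearMap ∘ₗ TensorProduct.map (b α) LinearMap.id

/-- The symmetric product `x ⊗ y + y ⊗ x`. -/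
def symMul (x y : V) : V ⊗[ℝ] V := x ⊗ₜ[ℝ] y + y ⊗ₜ[ℝ] x

lemma reflB_apply (α x : V) : reflB b α x = x - b α x • α := by
  simp [reflB]

lemma reflSq_tmul (α x y : V) :
    reflSq b α (x ⊗ₜ[ℝ] y) = (x - b α x • α) ⊗ₜ[ℝ] (y - b α y • α) := by
  simp [reflSq, reflB_apply]

lemma contract_tmul (α x y : V) : contract b α (x ⊗ₜ[ℝ] y) = b α x • y := by
  simp [contract]

lemma reflSq_apply (α : V) (w : V ⊗[ℝ] V) :
    reflSq b α w = w - α ⊗ₜ[ℝ] contract b α w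
      - contract b α (TensorProduct.comm ℝ V V w) ⊗ₜ[ℝ] α
      + b α (contract b α w) • (α ⊗ₜ[ℝ] α) := by
  induction w with
  | zero => simp
  | tmul x y =>
    simp only [reflSq_tmul, contract_tmul, TensorProduct.comm_tmul, TensorProduct.tmul_sub,
      TensorProduct.sub_tmul, TensorProduct.tmul_smul, ← TensorProduct.smul_tmul', map_smul,
      smul_eq_mul]
    module
  | add x y hx hy =>
    simp only [map_add, hx, hy, TensorProduct.tmul_add, TensorProduct.add_tmul, add_smul]
    abel

lemma reflSq_apply_of_comm_eq (α : V) {w : V ⊗[ℝ] V} (hw : TensorProduct.comm ℝ V V w = w) :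
    reflSq b α w = w - symMul α (contract b α w - (b α (contract b α w) / 2) • α) := by
  rw [reflSq_apply, hw]
  simp only [symMul, TensorProduct.tmul_sub, TensorProduct.sub_tmul, TensorProduct.tmul_smul,
    ← TensorProduct.smul_tmul']
  module

lemma reflSq_symMul (γ x y : V) :
    reflSq b γ (symMul x y) =
      symMul x y - symMul γ (b γ x • y + b γ y • x - (b γ x * b γ y) • γ) := by
  simp only [symMul, map_add, reflSq_tmul, TensorProduct.tmul_sub, TensorProduct.sub_tmul,
    TensorProduct.tmul_smul, ← TensorProduct.smul_tmul', TensorProduct.tmul_add,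
    TensorProduct.add_tmul]
  module

lemma comm_reflSq (α : V) (w : V ⊗[ℝ] V) :
    TensorProduct.comm ℝ V V (reflSq b α w) = reflSq b α (TensorProduct.comm ℝ V V w) := by
  induction w with
  | zero => simp
  | tmul x y => simp [reflSq]
  | add x y hx hy => simp only [map_add, hx, hy]

lemma tmul_form_symMul_self {α v : V} (hα : b α α = 2) (hv : b α v = 0) (hv' : b v α = 0) :
    LinearMap.BilinForm.tmul b b (symMul α v) (symMul α v) = 4 * b v v := by
  simp [symMul, hα, hv, hv']
  ring

variable {b}

lemma reflB_reflB {α : V} (hα : b α α = 2) (x : V) : reflB b α (reflB b α x) = x := by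
  simp only [reflB_apply, map_sub, map_smul, hα]
  module

lemma apply_reflB_reflB (hb : b.IsSymm) {α : V} (hα : b α α = 2) (x y : V) :
    b (reflB b α x) (reflB b α y) = b x y := by
  simp only [reflB_apply, map_sub, map_smul, smul_eq_mul, hα, LinearMap.sub_apply,
    LinearMap.smul_apply]
  rw [show b x α = b α x from hb.eq x α]
  ring

lemma reflSq_reflSq {α : V} (hα : b α α = 2) (w : V ⊗[ℝ] V) :
    reflSq b α (reflSq b α w) = w := by
  induction w with
  | zero => simp
  | tmul x y => simp [reflSq, reflB_reflB hα]
  | add x y hx hy => simp only [map_add, hx, hy]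

lemma tmul_form_reflSq (hb : b.IsSymm) {α : V} (hα : b α α = 2) (w z : V ⊗[ℝ] V) :
    LinearMap.BilinForm.tmul b b (reflSq b α w) (reflSq b α z) =
      LinearMap.BilinForm.tmul b b w z := by
  induction w with
  | zero => simp
  | add x y hx hy => simp only [map_add, LinearMap.add_apply, hx, hy]
  | tmul x y =>
    induction z with
    | zero => simp
    | add x y hx hy => simp only [map_add, hx, hy]
    | tmul x' y' => simp [reflSq, apply_reflB_reflB hb hα]

lemma reflB_conj (hb : b.IsSymm) {γ : V} (hγ : b γ γ = 2) (δ x : V) :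
    reflB b (reflB b γ δ) x = reflB b γ (reflB b δ (reflB b γ x)) := by
  have h : b (reflB b γ δ) x = b δ (reflB b γ x) := by
    conv_lhs => rw [← reflB_reflB hγ x]
    exact apply_reflB_reflB hb hγ _ _
  rw [reflB_apply b (reflB b γ δ), h, reflB_apply b δ, map_sub, map_smul, reflB_reflB hγ]

lemma reflSq_conj (hb : b.IsSymm) {γ : V} (hγ : b γ γ = 2) (δ : V) (w : V ⊗[ℝ] V) :
    reflSq b (reflB b γ δ) w = reflSq b γ (reflSq b δ (reflSq b γ w)) := by
  induction w with
  | zero => simp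
  | tmul x y => simp [reflSq, reflB_conj hb hγ]
  | add x y hx hy => simp only [map_add, hx, hy]

variable (b)

/-- `γ` has norm `2` and its reflection preserves the subspace `N` of `V ⊗ V`. -/
def PreservingRoot (N : Submodule ℝ (V ⊗[ℝ] V)) (γ : V) : Prop :=
  b γ γ = 2 ∧ ∀ x ∈ N, reflSq b γ x ∈ N

variable {b} {N : Submodule ℝ (V ⊗[ℝ] V)}

lemma PreservingRoot.reflB (hb : b.IsSymm) {γ δ : V} (hγ : PreservingRoot b N γ)
    (hδ : PreservingRoot b N δ) : PreservingRoot b N (reflB b γ δ) := by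
  refine ⟨by rw [apply_reflB_reflB hb hγ.1, hδ.1], fun x hx => ?_⟩
  rw [reflSq_conj hb hγ.1]
  exact hγ.2 _ (hδ.2 _ (hγ.2 _ hx))

lemma PreservingRoot.symMul_mem {γ x y : V} (hγ : PreservingRoot b N γ)
    (h : symMul x y ∈ N) :
    symMul γ (b γ x • y + b γ y • x - (b γ x * b γ y) • γ) ∈ N := by
  have := N.sub_mem h (hγ.2 _ h)
  rwa [reflSq_symMul, sub_sub_cancel] at this

/-- In a totally isotropic subspace, a product `α · v` with `v ⊥ α` forces `v` to be isotropic. -/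
lemma isotropic_of_symMul_mem (hb : b.IsSymm)
    (hN : ∀ x ∈ N, LinearMap.BilinForm.tmul b b x x = 0)
    {α v : V} (hα : b α α = 2) (hv : b α v = 0) (h : symMul α v ∈ N) : b v v = 0 := by
  have hv' : b v α = 0 := (hb.eq α v).symm.trans hv
  have := hN _ h
  rw [tmul_form_symMul_self b hα hv hv'] at this
  linarith

/-- If `α · v` lies in a totally isotropic subspace, `v` is orthogonal to every root that is
neither at angle `π/3` nor at angle `2π/3` with `α`. -/
lemma PreservingRoot.apply_eq_zero (hb : b.IsSymm)
    (hN : ∀ x ∈ N, LinearMap.BilinForm.tmul b b x x = 0)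
    {α γ v : V} (hα : b α α = 2) (hγ : PreservingRoot b N γ) (hv : b α v = 0)
    (h : symMul α v ∈ N) (hαγ : b γ α ^ 2 ≠ 1) : b γ v = 0 := by
  have hvv := isotropic_of_symMul_mem hb hN hα hv h
  have hu := isotropic_of_symMul_mem hb hN hγ.1 (by simp [hγ.1]; ring) (hγ.symMul_mem h)
  have hsv : b v γ = b γ v := hb.eq v γ
  have hsα : b α γ = b γ α := hb.eq α γ
  have hvα : b v α = 0 := (hb.eq α v).symm.trans hv
  simp only [map_sub, map_add, map_smul, smul_eq_mul, LinearMap.sub_apply, LinearMap.add_apply,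
    LinearMap.smul_apply, hvv, hsv, hsα, hvα, hv, hα, hγ.1] at hu
  have : b γ v ^ 2 * (1 - b γ α ^ 2) = 0 := by linear_combination hu / 2
  rcases mul_eq_zero.1 this with h0 | h0
  · exact pow_eq_zero_iff two_ne_zero |>.1 h0
  · exact absurd (by linarith) hαγ

/-- If `α · v` lies in a totally isotropic subspace, `v` takes opposite values on any two roots
`β`, `β'` which make the angle `2π/3` with `α` and are either orthogonal or at angle `2π/3`. -/
lemma PreservingRoot.apply_add_apply_eq_zero (hb : b.IsSymm)
    (hN : ∀ x ∈ N, LinearMap.BilinForm.tmul b b x x = 0)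
    {α β β' v : V} (hα : PreservingRoot b N α) (hβ : PreservingRoot b N β)
    (hβ' : PreservingRoot b N β') (hv : b α v = 0) (h : symMul α v ∈ N)
    (hβα : b β α = -1) (hβα' : b β' α = -1) (hββ : b β' β = 0 ∨ b β' β = -1) :
    b β v + b β' v = 0 := by
  rcases hββ with h0 | h1
  · have := (hβ'.reflB hb (hβ.reflB hb hα)).apply_eq_zero hb hN hα.1 hv h
      (by simp [reflB_apply, hβα, hβα', h0, hα.1]; norm_num)
    simpa [reflB_apply, hβα, hβα', h0, hv] using this
  · have := (hβ'.reflB hb hβ).apply_eq_zero hb hN hα.1 hv h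
      (by simp [reflB_apply, hβα, hβα', h1]; norm_num)
    simpa [reflB_apply, h1] using this

/-- The products `α · v` in an invariant subspace are transported along an edge of the graph. -/
lemma PreservingRoot.eq_zero_of_adjacent (hb : b.IsSymm)
    {α β v : V} (hα : PreservingRoot b N α) (hβ : PreservingRoot b N β)
    (hβα : b β α = -1) (hβ0 : ∀ u, b β u = 0 → symMul β u ∈ N → u = 0)
    (hv : b α v = 0) (h : symMul α v ∈ N) : v = 0 := by
  have hu := hβ0 _ (by simp [hβ.1]; ring) (hβ.symMul_mem h)
  have hsα : b α β = -1 := (hb.eq β α).symm.trans hβα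
  have h0 := congrArg (b α) hu
  simp [hα.1, hv, hβα, hsα] at h0
  have : b β v = 0 := by linarith
  simpa [this, hβα] using hu

end Reflections

section Cartan

variable {n : ℕ} {A : Matrix (Fin n) (Fin n) ℤ}

lemma formA_single_single (A : Matrix (Fin n) (Fin n) ℤ) (i j : Fin n) :
    formA A (Pi.single i 1) (Pi.single j 1) = A i j := by
  simp [formA]

lemma formA_single (A : Matrix (Fin n) (Fin n) ℤ) (i : Fin n) (v : Fin n → ℝ) :
    formA A (Pi.single i 1) v = ((A.map ((↑) : ℤ → ℝ)).mulVec v) i := by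
  simp [formA, Matrix.toBilin'_apply']

lemma formA_apply (A : Matrix (Fin n) (Fin n) ℤ) (x y : Fin n → ℝ) :
    formA A x y = ∑ i, ∑ j, x i * A i j * y j := by
  simp [formA, Matrix.toBilin'_apply]

lemma symmetric_of_simplyLaced
    (hoffdiag : ∀ i j, i ≠ j → A i j = 0 ∨ A i j = -1)
    (hzero : ∀ i j, A i j = 0 ↔ A j i = 0) (i j : Fin n) : A i j = A j i := by
  by_cases h : i = j
  · rw [h]
  · have := hzero i j
    have := hoffdiag i j h
    have := hoffdiag j i (Ne.symm h)
    lia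

lemma formA_isSymm (hA : ∀ i j, A i j = A j i) : (formA A).IsSymm := by
  refine ⟨fun x y => ?_⟩
  simp only [formA_apply]
  rw [Finset.sum_comm]
  refine Finset.sum_congr rfl fun i _ => Finset.sum_congr rfl fun j _ => ?_
  rw [hA j i]
  ring

lemma eq_zero_of_formA_single_eq_zero {ωInv : Matrix (Fin n) (Fin n) ℝ}
    (hωl : ωInv * A.map ((↑) : ℤ → ℝ) = 1) {v : Fin n → ℝ}
    (h : ∀ i, formA A (Pi.single i 1) v = 0) : v = 0 := by
  have h0 : (A.map ((↑) : ℤ → ℝ)).mulVec v = 0 := by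
    ext i
    rw [← formA_single, h]
    rfl
  rw [← Matrix.one_mulVec v, ← hωl, ← Matrix.mulVec_mulVec, h0, Matrix.mulVec_zero]

/-- A symmetric matrix with nonpositive off-diagonal entries and nonnegative row sums is
positive semidefinite. -/
lemma formA_self_nonneg (hA : ∀ i j, A i j = A j i) (hneg : ∀ i j, i ≠ j → A i j ≤ 0)
    (hrow : ∀ i, 0 ≤ ∑ j, A i j) (x : Fin n → ℝ) : 0 ≤ formA A x x := by
  have hswap : ∑ i, ∑ j, (A i j : ℝ) * x j ^ 2 = ∑ i, ∑ j, (A i j : ℝ) * x i ^ 2 := by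
    rw [Finset.sum_comm]
    simp_rw [fun i j => hA j i]
  have hdecomp : 2 * formA A x x =
      2 * ∑ i, ∑ j, (A i j : ℝ) * x i ^ 2 - ∑ i, ∑ j, (A i j : ℝ) * (x i - x j) ^ 2 := by
    have : ∑ i, ∑ j, (A i j : ℝ) * (x i - x j) ^ 2 =
        ∑ i, ∑ j, (A i j : ℝ) * x i ^ 2 + ∑ i, ∑ j, (A i j : ℝ) * x j ^ 2
          - 2 * formA A x x := by
      rw [formA_apply]
      simp only [Finset.mul_sum, ← Finset.sum_add_distrib, ← Finset.sum_sub_distrib]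
      exact Finset.sum_congr rfl fun i _ => Finset.sum_congr rfl fun j _ => by ring
    rw [this, hswap]
    ring
  have h1 : 0 ≤ ∑ i, ∑ j, (A i j : ℝ) * x i ^ 2 := by
    refine Finset.sum_nonneg fun i _ => ?_
    rw [← Finset.sum_mul]
    exact mul_nonneg (by exact_mod_cast hrow i) (sq_nonneg _)
  have h2 : ∑ i, ∑ j, (A i j : ℝ) * (x i - x j) ^ 2 ≤ 0 := by
    refine Finset.sum_nonpos fun i _ => Finset.sum_nonpos fun j _ => ?_
    by_cases h : i = j
    · simp [h]
    · exact mul_nonpos_of_nonpos_of_nonneg (by exact_mod_cast hneg i j h) (sq_nonneg _)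
  linarith

/-- A vertex with negative row sum has, besides any given neighbour, two further ones. -/
lemma exists_two_further_neighbours (hdiag : ∀ i, A i i = 2)
    (hoffdiag : ∀ i j, i ≠ j → A i j = 0 ∨ A i j = -1) {i : Fin n}
    (hrow : ∑ j, A i j < 0) (j : Fin n) :
    ∃ k l, k ≠ j ∧ l ≠ j ∧ k ≠ l ∧ A i k = -1 ∧ A i l = -1 := by
  classical
  let S : Finset (Fin n) := Finset.univ.filter fun k => A i k = -1
  have hsum : ∑ k, A i k = 2 - (S.card : ℤ) := by
    have : ∀ k, A i k = (if k = i then 2 else 0) - (if A i k = -1 then 1 else 0) := by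
      intro k
      by_cases h : k = i
      · subst h
        simp [hdiag]
      · rcases hoffdiag i k (Ne.symm h) with h' | h' <;> simp [h, h']
    rw [Finset.sum_congr rfl fun k _ => this k, Finset.sum_sub_distrib]
    simp [S]
  have hcard : 1 < (S.erase j).card := by
    have := Finset.pred_card_le_card_erase (s := S) (a := j)
    omega
  obtain ⟨k, hk, l, hl, hkl⟩ := Finset.one_lt_card.1 hcard
  simp only [S, Finset.mem_erase, Finset.mem_filter, Finset.mem_univ, true_and] at hk hl
  exact ⟨k, l, hk.1, hl.1, hkl, hk.2, hl.2⟩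

lemma tensor_eq_sum_contract {ωInv : Matrix (Fin n) (Fin n) ℝ}
    (hωl : ωInv * A.map ((↑) : ℤ → ℝ) = 1) (w : (Fin n → ℝ) ⊗[ℝ] (Fin n → ℝ)) :
    w = ∑ k, ∑ l, ωInv k l • ((Pi.single k 1 : Fin n → ℝ) ⊗ₜ[ℝ]
      contract (formA A) (Pi.single l 1) w) := by
  induction w with
  | zero => simp
  | add x y hx hy =>
    simp only [map_add, TensorProduct.tmul_add, smul_add, Finset.sum_add_distrib]
    rw [← hx, ← hy]
  | tmul x y =>
    have hx : x = ∑ k, ∑ l, (ωInv k l * formA A (Pi.single l 1) x) •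
        (Pi.single k 1 : Fin n → ℝ) := by
      have h : ωInv.mulVec ((A.map ((↑) : ℤ → ℝ)).mulVec x) = x := by
        rw [Matrix.mulVec_mulVec, hωl, Matrix.one_mulVec]
      conv_lhs => rw [← h, pi_eq_sum_univ' (ωInv.mulVec _)]
      refine Finset.sum_congr rfl fun k _ => ?_
      rw [← Finset.sum_smul]
      simp only [formA_single]
      rfl
    conv_lhs => rw [hx]
    simp only [TensorProduct.sum_tmul, contract_tmul, TensorProduct.tmul_smul,
      ← TensorProduct.smul_tmul', smul_smul]

lemma contract_psiElt {ωInv : Matrix (Fin n) (Fin n) ℝ}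
    (hωr : A.map ((↑) : ℤ → ℝ) * ωInv = 1) (i : Fin n) :
    contract (formA A) (Pi.single i 1) (PsiElt ωInv) = Pi.single i 1 := by
  simp only [PsiElt, map_sum, map_smul, contract_tmul, formA_single_single, smul_smul]
  rw [Finset.sum_comm]
  ext j
  have h := congrFun (congrFun hωr i) j
  simp only [Matrix.mul_apply, Matrix.map_apply, Matrix.one_apply] at h
  simp only [Finset.sum_apply, Pi.smul_apply, Pi.single_apply, smul_eq_mul, mul_ite, mul_one,
    mul_zero, Finset.sum_ite_irrel, Finset.sum_const_zero, Finset.sum_ite_eq, Finset.mem_univ,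
    if_true]
  simp only [mul_comm (ωInv _ _), h, eq_comm]

lemma comm_psiElt (hA : ∀ i j, A i j = A j i) {ωInv : Matrix (Fin n) (Fin n) ℝ}
    (hωr : A.map ((↑) : ℤ → ℝ) * ωInv = 1) :
    TensorProduct.comm ℝ _ _ (PsiElt ωInv) = PsiElt ωInv := by
  have hAt : (A.map ((↑) : ℤ → ℝ)).transpose = A.map ((↑) : ℤ → ℝ) := by
    ext i j
    simp [hA i j]
  have hω : ωInv.transpose = ωInv := by
    have h := congrArg Matrix.transpose hωr
    rw [Matrix.transpose_mul, hAt, Matrix.transpose_one] at h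
    exact left_inv_eq_right_inv h hωr
  simp only [PsiElt, map_sum, map_smul, TensorProduct.comm_tmul]
  rw [Finset.sum_comm]
  refine Finset.sum_congr rfl fun k _ => Finset.sum_congr rfl fun l _ => ?_
  rw [← Matrix.transpose_apply ωInv k l, hω]

lemma form2_psiElt_self {ωInv : Matrix (Fin n) (Fin n) ℝ}
    (hωl : ωInv * A.map ((↑) : ℤ → ℝ) = 1) (hωr : A.map ((↑) : ℤ → ℝ) * ωInv = 1) :
    form2 A (PsiElt ωInv) (PsiElt ωInv) = n := by
  have hcontract : ∀ (w : (Fin n → ℝ) ⊗[ℝ] (Fin n → ℝ)) (x y : Fin n → ℝ),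
      form2 A (x ⊗ₜ[ℝ] y) w = formA A y (contract (formA A) x w) := by
    intro w x y
    induction w with
    | zero => simp
    | tmul u v => simp [form2, contract_tmul, mul_comm]
    | add u v hu hv => simp only [map_add, hu, hv]
  conv_lhs => arg 1; rw [PsiElt]
  simp only [map_sum, map_smul, LinearMap.sum_apply, LinearMap.smul_apply, hcontract,
    contract_psiElt hωr, formA_single_single, smul_eq_mul]
  have h := congrArg Matrix.trace hωl
  simp only [Matrix.trace, Matrix.diag, Matrix.mul_apply, Matrix.map_apply] at h
  simpa using h

/-- An eigenvalue assignment compatible with a connected symmetric form is constant. -/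
lemma eq_of_connected
    (hconn : ∀ i j : Fin n, Relation.ReflTransGen (fun a b => a ≠ b ∧ A a b ≠ 0) i j)
    {c : Fin n → ℝ} (hc : ∀ i j, c i * A i j = c j * A i j) (i j : Fin n) : c i = c j := by
  induction hconn i j with
  | refl => rfl
  | tail _ h ih =>
    rw [ih]
    exact mul_right_cancel₀ (by exact_mod_cast h.2) (hc _ _)

lemma formA_contract_comm {w : (Fin n → ℝ) ⊗[ℝ] (Fin n → ℝ)} (x y : Fin n → ℝ) :
    formA A y (contract (formA A) x w) =
      formA A x (contract (formA A) y (TensorProduct.comm ℝ _ _ w)) := by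
  induction w with
  | zero => simp
  | tmul u v => simp [contract_tmul, mul_comm]
  | add u v hu hv => simp only [map_add, hu, hv]

/-- A symmetric tensor all of whose contractions with the simple roots `α` are multiples of `α`
is a multiple of `Ψ`. -/
lemma eq_smul_psiElt_of_contract
    (hA : ∀ i j, A i j = A j i)
    (hconn : ∀ i j : Fin n, Relation.ReflTransGen (fun a b => a ≠ b ∧ A a b ≠ 0) i j)
    {ωInv : Matrix (Fin n) (Fin n) ℝ} (hωl : ωInv * A.map ((↑) : ℤ → ℝ) = 1)
    {w : (Fin n → ℝ) ⊗[ℝ] (Fin n → ℝ)} (hw : TensorProduct.comm ℝ _ _ w = w)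
    {c : Fin n → ℝ}
    (hc : ∀ i, contract (formA A) (Pi.single i 1) w = c i • (Pi.single i 1 : Fin n → ℝ)) :
    ∃ d : ℝ, w = d • PsiElt ωInv := by
  have hcomm : ∀ i j, c i * A i j = c j * A i j := by
    intro i j
    have h := formA_contract_comm (A := A) (w := w) (Pi.single i 1) (Pi.single j 1)
    rw [hw, hc, hc] at h
    simpa [formA_single_single, hA j i] using h
  obtain ⟨d, hd⟩ : ∃ d, ∀ i, c i = d := by
    rcases isEmpty_or_nonempty (Fin n) with _ | ⟨⟨i⟩⟩
    · exact ⟨0, fun i => isEmptyElim i⟩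
    · exact ⟨c i, fun j => eq_of_connected hconn hcomm j i⟩
  refine ⟨d, ?_⟩
  rw [tensor_eq_sum_contract hωl w, PsiElt]
  simp only [hc, hd, TensorProduct.tmul_smul, Finset.smul_sum]
  exact Finset.sum_congr rfl fun k _ => Finset.sum_congr rfl fun l _ => smul_comm _ _ _

lemma eq_zero_of_symMul_eq_zero {b : LinearMap.BilinForm ℝ (Fin n → ℝ)} {α v : Fin n → ℝ}
    (hα : b α α = 2) (hv : b α v = 0) (h : symMul α v = 0) : v = 0 := by
  have := congrArg (contract b α) h
  simp only [symMul, map_add, contract_tmul, hα, hv, zero_smul, add_zero, map_zero] at this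
  simpa using this

/-- In a totally isotropic subspace invariant under the simple reflections there is no nonzero
product `e_i · v` with `v ⊥ e_i`. -/
lemma eq_zero_of_symMul_mem
    (hdiag : ∀ i, A i i = 2)
    (hoffdiag : ∀ i j, i ≠ j → A i j = 0 ∨ A i j = -1)
    (hA : ∀ i j, A i j = A j i)
    (hconn : ∀ i j : Fin n, Relation.ReflTransGen (fun a b => a ≠ b ∧ A a b ≠ 0) i j)
    {ωInv : Matrix (Fin n) (Fin n) ℝ} (hωl : ωInv * A.map ((↑) : ℤ → ℝ) = 1)
    {N : Submodule ℝ ((Fin n → ℝ) ⊗[ℝ] (Fin n → ℝ))}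
    (hinv : ∀ i, ∀ x ∈ N, ssA A i x ∈ N) (hN : ∀ x ∈ N, form2 A x x = 0)
    (i : Fin n) {v : Fin n → ℝ} (hv : formA A (Pi.single i 1) v = 0)
    (h : symMul (Pi.single i 1) v ∈ N) : v = 0 := by
  have hb := formA_isSymm hA
  have hroot : ∀ i, PreservingRoot (formA A) N (Pi.single i 1) := fun i =>
    ⟨by rw [formA_single_single, hdiag]; norm_num, hinv i⟩
  by_cases hrow : ∀ i, 0 ≤ ∑ j, A i j
  · have hpos := formA_self_nonneg hA
      (fun i j hij => by rcases hoffdiag i j hij with h | h <;> simp [h]) hrow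
    have hvv := isotropic_of_symMul_mem hb hN (hroot i).1 hv h
    refine eq_zero_of_formA_single_eq_zero hωl fun j => ?_
    have := LinearMap.BilinForm.apply_sq_le_of_symm (formA A) hpos ⟨hb.eq⟩ (Pi.single j 1) v
    rw [hvv, mul_zero] at this
    exact pow_eq_zero_iff two_ne_zero |>.1 (le_antisymm this (sq_nonneg _))
  push Not at hrow
  obtain ⟨k, hk⟩ := hrow
  have hbase : ∀ u, formA A (Pi.single k 1) u = 0 → symMul (Pi.single k 1) u ∈ N → u = 0 := by
    intro u hu hmem
    have hpair : ∀ j l, j ≠ l → A k j = -1 → A k l = -1 →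
        formA A (Pi.single j 1) u + formA A (Pi.single l 1) u = 0 := by
      intro j l hjl hj hl
      refine (hroot k).apply_add_apply_eq_zero hb hN (hroot j) (hroot l) hu hmem ?_ ?_ ?_
      · rw [formA_single_single, hA, hj]; norm_num
      · rw [formA_single_single, hA, hl]; norm_num
      · rw [formA_single_single]
        exact_mod_cast hoffdiag l j hjl.symm
    refine eq_zero_of_formA_single_eq_zero hωl fun j => ?_
    by_cases hjk : j = k
    · rw [hjk, hu]
    rcases hoffdiag k j (Ne.symm hjk) with h0 | h1
    · refine (hroot j).apply_eq_zero hb hN (hroot k).1 hu hmem ?_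
      rw [formA_single_single, hA, h0]
      norm_num
    · obtain ⟨l, m, hlj, hmj, hlm, hl, hm⟩ :=
        exists_two_further_neighbours hdiag hoffdiag hk j
      linarith [hpair j l hlj.symm h1 hl, hpair j m hmj.symm h1 hm, hpair l m hlm hl hm]
  have hall : ∀ j, ∀ u, formA A (Pi.single j 1) u = 0 → symMul (Pi.single j 1) u ∈ N →
      u = 0 := by
    intro j
    induction hconn k j with
    | refl => exact hbase
    | @tail j l _ hadj ih =>
      intro u hu hmem
      refine (hroot l).eq_zero_of_adjacent hb (hroot j) ?_ ih hu hmem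
      rw [formA_single_single, (hoffdiag j l hadj.1).resolve_left hadj.2]
      norm_num
  exact hall i v hv h

/-- A totally isotropic subspace of `Sym²(V)` invariant under the simple reflections vanishes. -/
lemma eq_bot_of_isotropic_of_invariant
    (hdiag : ∀ i, A i i = 2)
    (hoffdiag : ∀ i j, i ≠ j → A i j = 0 ∨ A i j = -1)
    (hA : ∀ i j, A i j = A j i)
    (hconn : ∀ i j : Fin n, Relation.ReflTransGen (fun a b => a ≠ b ∧ A a b ≠ 0) i j)
    {ωInv : Matrix (Fin n) (Fin n) ℝ} (hωl : ωInv * A.map ((↑) : ℤ → ℝ) = 1)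
    (hωr : A.map ((↑) : ℤ → ℝ) * ωInv = 1)
    {N : Submodule ℝ ((Fin n → ℝ) ⊗[ℝ] (Fin n → ℝ))} (hsym : N ≤ sym2 n)
    (hinv : ∀ i, ∀ x ∈ N, ssA A i x ∈ N) (hN : ∀ x ∈ N, form2 A x x = 0) : N = ⊥ := by
  rw [Submodule.eq_bot_iff]
  intro w hw
  have hwc : TensorProduct.comm ℝ _ _ w = w := hsym hw
  have hdiag' : ∀ i, formA A (Pi.single i 1) (Pi.single i 1) = 2 := fun i => by
    rw [formA_single_single, hdiag]; norm_num
  obtain ⟨d, hd⟩ := eq_smul_psiElt_of_contract hA hconn hωl hwc (c := fun i =>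
      formA A (Pi.single i 1) (contract (formA A) (Pi.single i 1) w) / 2) (fun i => by
    refine sub_eq_zero.1 (eq_zero_of_symMul_mem hdiag hoffdiag hA hconn hωl hinv hN i ?_ ?_)
    · simp [hdiag']
    · have h := N.sub_mem hw (hinv i w hw)
      change w - reflSq _ _ w ∈ N at h
      rwa [reflSq_apply_of_comm_eq _ _ hwc, sub_sub_cancel] at h)
  have h0 := hN w hw
  rw [hd] at h0
  simp only [map_smul, LinearMap.smul_apply, form2_psiElt_self hωl hωr, smul_eq_mul] at h0
  rcases mul_eq_zero.1 h0 with h | h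
  · rw [hd, h, zero_smul]
  rcases mul_eq_zero.1 h with h | h
  · rw [hd, h, zero_smul]
  · obtain rfl : n = 0 := by exact_mod_cast h
    rw [hd, PsiElt]
    simp

end Cartan

/-- For an indecomposable, invertible, simply-laced GCM, `ℝΨ` is the space of
`W(A)`-invariants in `Sym²(V)`, and every invariant submodule of `Sym²(V)` meets its
orthogonal complement trivially; hence `Sym²(V)` is a completely reducible
`W(A)`-module. -/
theorem statement16 {n : ℕ} (A : Matrix (Fin n) (Fin n) ℤ)
    (hdiag : ∀ i, A i i = 2)
    (hoffdiag : ∀ i j, i ≠ j → A i j = 0 ∨ A i j = -1)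
    (hzero : ∀ i j, A i j = 0 ↔ A j i = 0)
    (hconn : ∀ i j : Fin n, Relation.ReflTransGen (fun a b => a ≠ b ∧ A a b ≠ 0) i j)
    (hreg : (A.map ((↑) : ℤ → ℝ)).det ≠ 0)
    (ωInv : Matrix (Fin n) (Fin n) ℝ)
    (hωl : ωInv * A.map ((↑) : ℤ → ℝ) = 1)
    (hωr : A.map ((↑) : ℤ → ℝ) * ωInv = 1) :
    (∀ w : (Fin n → ℝ) ⊗[ℝ] (Fin n → ℝ),
      ((TensorProduct.comm ℝ (Fin n → ℝ) (Fin n → ℝ)) w = w ∧ ∀ i, ssA A i w = w)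
        ↔ ∃ c : ℝ, w = c • PsiElt ωInv) ∧
    (∀ U : Submodule ℝ ((Fin n → ℝ) ⊗[ℝ] (Fin n → ℝ)), U ≤ sym2 n →
      (∀ i, ∀ x ∈ U, ssA A i x ∈ U) →
        U ⊓ (sym2 n ⊓ (form2 A).orthogonal U) = ⊥ ∧
        U ⊔ (sym2 n ⊓ (form2 A).orthogonal U) = sym2 n ∧
        (∀ i, ∀ x ∈ sym2 n ⊓ (form2 A).orthogonal U,
          ssA A i x ∈ sym2 n ⊓ (form2 A).orthogonal U)) := by
  have hA := symmetric_of_simplyLaced hoffdiag hzero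
  have hb := formA_isSymm hA
  have hdiag' : ∀ i, formA A (Pi.single i 1) (Pi.single i 1) = 2 := fun i => by
    rw [formA_single_single, hdiag]; norm_num
  have hrefl : (form2 A).IsRefl :=
    (LinearMap.IsSymm.tmul (B₁ := formA A) (B₂ := formA A) ⟨hb.eq⟩ ⟨hb.eq⟩).isRefl
  refine ⟨fun w => ⟨fun ⟨hw, hfix⟩ => ?_, ?_⟩, fun U hU hinv => ?_⟩
  · refine eq_smul_psiElt_of_contract hA hconn hωl hw (c := fun i =>
      formA A (Pi.single i 1) (contract (formA A) (Pi.single i 1) w) / 2) fun i => ?_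
    refine sub_eq_zero.1 (eq_zero_of_symMul_eq_zero (hdiag' i) (by simp [hdiag']) ?_)
    have h := hfix i
    change reflSq _ _ w = w at h
    rwa [reflSq_apply_of_comm_eq _ _ hw, sub_eq_self] at h
  · rintro ⟨c, rfl⟩
    have hΨ := comm_psiElt hA hωr
    refine ⟨by rw [map_smul, hΨ], fun i => ?_⟩
    rw [map_smul]
    congr 1
    change reflSq _ _ _ = _
    rw [reflSq_apply_of_comm_eq _ _ hΨ, contract_psiElt hωr, hdiag']
    simp [symMul]
  have hperp : ∀ i, ∀ x ∈ sym2 n ⊓ (form2 A).orthogonal U,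
      ssA A i x ∈ sym2 n ⊓ (form2 A).orthogonal U := by
    rintro i x ⟨hx, hxU⟩
    refine ⟨?_, fun u hu => ?_⟩
    · change TensorProduct.comm ℝ _ _ (reflSq _ _ x) = reflSq _ _ x
      rw [comm_reflSq, show TensorProduct.comm ℝ _ _ x = x from hx]
    · have h := hxU _ (hinv i u hu)
      change form2 A u (reflSq (formA A) (Pi.single i 1) x) = 0
      rw [← reflSq_reflSq (hdiag' i) u]
      exact (tmul_form_reflSq hb (hdiag' i) _ _).trans h
  have hbot : U ⊓ (sym2 n ⊓ (form2 A).orthogonal U) = ⊥ :=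
    eq_bot_of_isotropic_of_invariant hdiag hoffdiag hA hconn hωl hωr
      (inf_le_left.trans hU) (fun i x hx => ⟨hinv i x hx.1, hperp i x hx.2⟩)
      (fun x hx => hx.2.2 x hx.1)
  refine ⟨hbot, ?_, hperp⟩
  have hdisj : Disjoint U ((form2 A).orthogonal U) := by
    rw [disjoint_iff, ← hbot, ← inf_assoc, inf_eq_left.2 hU]
  have hcompl := LinearMap.BilinForm.isCompl_orthogonal_of_restrict_nondegenerate hrefl
    (LinearMap.BilinForm.nondegenerate_restrict_of_disjoint_orthogonal _ hrefl hdisj)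
  rw [inf_comm, ← sup_inf_assoc_of_le _ hU, hcompl.sup_eq_top, top_inf_eq]
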